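/- arXiv:1603.02961 — 4 statements merged into one kernel-verified Lean document; each statement's English description precedes it below -/
import Mathlib

section
/- There exist a₀ > 0 and, for every real a with |a| < a₀, a real number γ(a) and a smooth, even, 2π-periodic function U_a : ℝ → ℝ satisfying ((γ(a) − U_a(z))·U_a'(z))' + U_a(z) = 0 for all z ∈ ℝ, such that: (i) for every integer n ≥ 0 there is a constant C_n > 0 with sup_{z∈ℝ} |(d/dz)ⁿ( U_a(z) − a·cos z − (a²/3)·cos 2z − (3a³/16)·cos 3z )| ≤ C_n·a⁴ for all |a| < a₀; (ii) there is C > 0 with |γ(a) − 1 − a²/6| ≤ C·a⁴ for all |a| < a₀; (iii) the function z ↦ (1/2)(γ(a) − U_a(z))²·U_a'(z)² + (γ(a)/2)·U_a(z)² − (1/3)·U_a(z)³ is constant in z, and its constant value I(a) satisfies |I(a) − a²/2| ≤ C·a⁴ for all |a| < a₀. -/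
open Real

/-- The multiplier `m² / (m² - 1)`, which vanishes for `m = 0` and, by convention, for `m = 1`. -/
noncomputable def modeMultiplier (m : ℕ) : ℝ := (m : ℝ) ^ 2 / ((m : ℝ) ^ 2 - 1)

lemma abs_modeMultiplier_le (m : ℕ) : |modeMultiplier m| ≤ 4 / 3 := by
  unfold modeMultiplier
  rcases Nat.lt_or_ge m 2 with h | h
  · interval_cases m <;> norm_num
  · have h2 : (2 : ℝ) ≤ m := by exact_mod_cast h
    have h3 : (0 : ℝ) < (m : ℝ) ^ 2 - 1 := by nlinarith
    rw [abs_of_nonneg (by positivity), div_le_iff₀ h3]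
    nlinarith

lemma modeMultiplier_mul_sub_one {m : ℕ} (hm : m ≠ 1) :
    modeMultiplier m * ((m : ℝ) ^ 2 - 1) = (m : ℝ) ^ 2 := by
  unfold modeMultiplier
  rcases Nat.eq_zero_or_pos m with rfl | h0
  · norm_num
  · have h2 : (2 : ℝ) ≤ m := by exact_mod_cast (by omega : 2 ≤ m)
    have h3 : (0 : ℝ) < (m : ℝ) ^ 2 - 1 := by nlinarith
    field_simp

/-- The interaction of the modes `j` and `l`, with values read off from `f`. -/
noncomputable def modeInteraction {F : Type*} [AddCommGroup F] [Module ℝ F] (t : ℝ) (f : ℕ → F)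
    (j l : ℕ) : F :=
  if j = 0 then (-2 * modeMultiplier l) • f l
  else if l = 0 then 0
  else (modeMultiplier (j + l) / 4) • f (j + l)
    + ((t ^ min j l * modeMultiplier (Nat.dist j l) / 4) • f (Nat.dist j l)
      + (if Nat.dist j l = 1 then 3 * t ^ min j l else 0) • f 0)

lemma map_modeInteraction {F G : Type*} [NormedAddCommGroup F] [NormedSpace ℝ F]
    [NormedAddCommGroup G] [NormedSpace ℝ G] (L : F →L[ℝ] G) (t : ℝ) (f : ℕ → F) (j l : ℕ) :
    L (modeInteraction t f j l) = modeInteraction t (fun k => L (f k)) j l := by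
  unfold modeInteraction
  split_ifs <;> simp

lemma norm_modeInteraction_le {F : Type*} [NormedAddCommGroup F] [NormedSpace ℝ F] {t M : ℝ}
    (ht0 : 0 ≤ t) (ht1 : t ≤ 1) {f : ℕ → F} (hf : ∀ k, ‖f k‖ ≤ M) (j l : ℕ) :
    ‖modeInteraction t f j l‖ ≤ 4 * M := by
  have hM : 0 ≤ M := (norm_nonneg _).trans (hf 0)
  have key : ∀ (c C : ℝ) (k : ℕ), |c| ≤ C → ‖c • f k‖ ≤ C * M := fun c C k h => by
    rw [norm_smul]
    exact mul_le_mul h (hf k) (norm_nonneg _) ((abs_nonneg _).trans h)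
  have hp0 : 0 ≤ t ^ min j l := by positivity
  have hp : t ^ min j l ≤ 1 := pow_le_one₀ ht0 ht1
  unfold modeInteraction
  split_ifs with h1 h2 h3
  · refine (key _ (8 / 3) l ?_).trans (by linarith)
    have := abs_modeMultiplier_le l
    rw [abs_mul]
    norm_num
    linarith
  · simpa using hM
  · rw [h3]
    have e1 := key (modeMultiplier (j + l) / 4) (1 / 3) (j + l) (by
      have := abs_modeMultiplier_le (j + l)
      rw [abs_div]
      norm_num
      linarith)
    have e2 := key (3 * t ^ min j l) 3 0 (by
      rw [abs_of_nonneg (by positivity)]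
      linarith)
    have e3 : modeMultiplier 1 = 0 := by simp [modeMultiplier]
    rw [e3]
    simp only [mul_zero, zero_div, zero_smul, zero_add]
    refine (norm_add_le _ _).trans ?_
    linarith
  · have e1 := key (modeMultiplier (j + l) / 4) (1 / 3) (j + l) (by
      have := abs_modeMultiplier_le (j + l)
      rw [abs_div]
      norm_num
      linarith)
    have e2 := key (t ^ min j l * modeMultiplier (Nat.dist j l) / 4) (1 / 3) (Nat.dist j l) (by
      have := abs_modeMultiplier_le (Nat.dist j l)
      rw [abs_div, abs_mul, abs_of_nonneg hp0, abs_of_pos (four_pos : (0 : ℝ) < 4)]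
      nlinarith [abs_nonneg (modeMultiplier (Nat.dist j l))])
    simp only [zero_smul, add_zero]
    refine (norm_add_le _ _).trans ?_
    linarith

lemma summable_norm_lp_one (w : lp (fun _ : ℕ => ℝ) 1) : Summable fun k => ‖w k‖ := by
  have := (lp.memℓp w).summable (by simp)
  simpa using this

lemma norm_lp_one_eq_tsum (w : lp (fun _ : ℕ => ℝ) 1) : ‖w‖ = ∑' k, ‖w k‖ := by
  simpa using lp.norm_eq_tsum_rpow (p := 1) (by simp) w

/-- A bounded sequence `f` in a Banach space induces a bounded operator on `ℓ¹`
sending `w` to `∑ w k • f k`. -/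
lemma exists_lp_one_lift {F : Type*} [NormedAddCommGroup F] [NormedSpace ℝ F] [CompleteSpace F]
    {f : ℕ → F} {M : ℝ} (hf : ∀ k, ‖f k‖ ≤ M) :
    ∃ L : lp (fun _ : ℕ => ℝ) 1 →L[ℝ] F, ‖L‖ ≤ M ∧ ∀ w, HasSum (fun k => w k • f k) (L w) := by
  have hM : 0 ≤ M := (norm_nonneg _).trans (hf 0)
  have hb : ∀ (w : lp (fun _ : ℕ => ℝ) 1) (k : ℕ), ‖w k • f k‖ ≤ ‖w k‖ * M := fun w k => by
    rw [norm_smul]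
    exact mul_le_mul_of_nonneg_left (hf k) (norm_nonneg _)
  have hs : ∀ w : lp (fun _ : ℕ => ℝ) 1, Summable fun k => w k • f k := fun w =>
    Summable.of_norm_bounded ((summable_norm_lp_one w).mul_right M) (hb w)
  refine ⟨LinearMap.mkContinuous
    { toFun := fun w => ∑' k, w k • f k
      map_add' := fun v w => ?_
      map_smul' := fun c w => ?_ } M ?_, LinearMap.mkContinuous_norm_le _ hM _,
      fun w => (hs w).hasSum⟩
  · rw [← (hs v).tsum_add (hs w)]
    simp [add_smul]
  · rw [RingHom.id_apply, ← (hs w).tsum_const_smul c]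
    simp [mul_smul]
  · intro w
    rw [norm_lp_one_eq_tsum, mul_comm, ← tsum_mul_right]
    exact tsum_of_norm_bounded ((summable_norm_lp_one w).mul_right M).hasSum (hb w)

lemma exists_eq_add_bilinear_self {E : Type*} [NormedAddCommGroup E] [NormedSpace ℝ E]
    [CompleteSpace E] (B : E →L[ℝ] E →L[ℝ] E) (x₀ : E) {C R : ℝ} (hR : 0 ≤ R) (hB : ‖B‖ ≤ C)
    (h₀ : ‖x₀‖ + C * R ^ 2 ≤ R) (h₁ : 2 * C * R < 1) :
    ∃ x, ‖x‖ ≤ R ∧ x = x₀ + B x x := by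
  have hC : 0 ≤ C := (norm_nonneg B).trans hB
  have hBle : ∀ x y, ‖B x y‖ ≤ C * ‖x‖ * ‖y‖ := fun x y =>
    (B.le_opNorm₂ x y).trans (by gcongr)
  have hmaps : Set.MapsTo (fun x => x₀ + B x x) (Metric.closedBall 0 R)
      (Metric.closedBall 0 R) := by
    intro x hx
    rw [mem_closedBall_zero_iff] at hx ⊢
    refine (norm_add_le _ _).trans (le_trans ?_ h₀)
    have : C * ‖x‖ * ‖x‖ ≤ C * R * R := by gcongr
    linarith [hBle x x]
  have hK : 0 ≤ 2 * C * R := by positivity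
  have hcon : ContractingWith ⟨2 * C * R, hK⟩ (hmaps.restrict _ _ _) := by
    refine ⟨by exact_mod_cast h₁, LipschitzWith.of_dist_le_mul ?_⟩
    rintro ⟨x, hx⟩ ⟨y, hy⟩
    rw [mem_closedBall_zero_iff] at hx hy
    simp only [Subtype.dist_eq, Set.MapsTo.val_restrict_apply, dist_eq_norm]
    have e : x₀ + B x x - (x₀ + B y y) = B (x - y) x + B y (x - y) := by
      simp only [map_sub, sub_apply]
      abel
    rw [e]
    change _ ≤ 2 * C * R * ‖x - y‖
    refine (norm_add_le _ _).trans ?_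
    have e1 : C * ‖x - y‖ * ‖x‖ ≤ C * ‖x - y‖ * R := by gcongr
    have e2 : C * ‖y‖ * ‖x - y‖ ≤ C * R * ‖x - y‖ := by gcongr
    have := hBle (x - y) x
    have := hBle y (x - y)
    linarith
  obtain ⟨x, hx, hfix, -⟩ := ContractingWith.exists_fixedPoint' Metric.isClosed_closedBall.isComplete
    hmaps hcon (Metric.mem_closedBall_self hR) (edist_ne_top _ _)
  exact ⟨x, by simpa using hx, hfix.symm⟩

lemma summable_mul_mul_of_bounded {w : ℕ → ℝ} (hw : Summable fun k => |w k|) {g : ℕ → ℕ → ℝ} {M : ℝ}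
    (hg : ∀ j l, |g j l| ≤ M) : Summable fun p : ℕ × ℕ => w p.1 * w p.2 * g p.1 p.2 := by
  have h := (summable_mul_of_summable_norm (f := w) (g := w) hw hw).norm.mul_right M
  refine Summable.of_norm_bounded h fun p => ?_
  rw [norm_mul]
  exact mul_le_mul_of_nonneg_left (hg _ _) (norm_nonneg _)

/-- Solvability of the rescaled mode equations, in weak form. -/
lemma exists_modes {t : ℝ} (ht0 : 0 ≤ t) (ht1 : t ≤ 1) :
    ∃ w : ℕ → ℝ, (Summable fun k => |w k|) ∧ ∑' k, |w k| ≤ 1 / 12 ∧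
      ∀ (φ : ℕ → ℝ) (M S : ℝ), (∀ k, |φ k| ≤ M) → HasSum (fun k => w k * φ k) S →
        HasSum (fun p : ℕ × ℕ => w p.1 * w p.2 * modeInteraction t φ p.1 p.2)
          (S - φ 1 / 24) := by
  have he : ∀ k : ℕ, ‖(lp.single 1 k (1 : ℝ) : lp (fun _ : ℕ => ℝ) 1)‖ ≤ 1 := fun k => by
    rw [lp.norm_single (by simp)]
    simp
  set e : ℕ → lp (fun _ : ℕ => ℝ) 1 := fun k => lp.single 1 k (1 : ℝ) with he_def
  have hrow : ∀ j, ∃ L : lp (fun _ : ℕ => ℝ) 1 →L[ℝ] lp (fun _ : ℕ => ℝ) 1, ‖L‖ ≤ 4 ∧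
      ∀ w, HasSum (fun k => w k • modeInteraction t e j k) (L w) := fun j =>
    exists_lp_one_lift fun k => by simpa using norm_modeInteraction_le ht0 ht1 he j k
  choose L hL hLs using hrow
  obtain ⟨B, hB, hBs⟩ := exists_lp_one_lift hL
  obtain ⟨w, hw, hfix⟩ := exists_eq_add_bilinear_self B ((1 / 24 : ℝ) • e 1) (C := 4) (R := 1 / 12)
    (by norm_num) hB (by
      rw [norm_smul]
      have h1 : ‖e 1‖ ≤ 1 := he 1
      norm_num
      linarith) (by norm_num)
  have hws := summable_norm_lp_one w
  refine ⟨fun k => w k, hws, by rwa [norm_lp_one_eq_tsum] at hw, fun φ M S hφ hS => ?_⟩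
  obtain ⟨Φ, -, hΦ⟩ := exists_lp_one_lift (f := φ) hφ
  have hΦe : (fun k => Φ (e k)) = φ := by
    funext k
    refine (hΦ (e k)).unique ?_
    convert hasSum_single k ?_ using 1
    · simp [he_def]
    · intro i hi
      simp [he_def, hi]
  have hS' : S = φ 1 / 24 + Φ (B w w) := by
    rw [hS.unique (hΦ w)]
    conv_lhs => rw [hfix]
    rw [map_add, map_smul, congrFun hΦe 1]
    simp only [smul_eq_mul]
    ring
  have hsum := (summable_mul_mul_of_bounded (M := 4 * M) hws
    (g := modeInteraction t φ)
    (norm_modeInteraction_le ht0 ht1 (f := φ) hφ)).hasSum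
  have hinner : ∀ j, HasSum (fun l => w j * w l * modeInteraction t φ j l)
      (w j * Φ (L j w)) := fun j => by
    have := (Φ.hasSum (hLs j w)).mul_left (w j)
    simpa [map_modeInteraction, hΦe, mul_assoc] using this
  have h1 := hsum.prod_fiberwise hinner
  have h2 : HasSum (fun j => w j * Φ (L j w)) (Φ (B w w)) := by
    have h3 := (ContinuousLinearMap.apply ℝ _ w).hasSum (hBs w)
    simpa using Φ.hasSum h3
  rw [hS', add_sub_cancel_left, ← h1.unique h2]
  exact hsum

/-- The series `∑ u k * cos (k * z + θ)`. -/
noncomputable def cosSeries (u : ℕ → ℝ) (θ z : ℝ) : ℝ := ∑' k : ℕ, u k * cos (k * z + θ)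

lemma summable_pow_mul_of_geometric_bound {u : ℕ → ℝ} {A : ℝ}
    (hu : ∀ k, |u k| ≤ A * (1 / 2) ^ k) (n : ℕ) : Summable fun k : ℕ => (k : ℝ) ^ n * |u k| := by
  refine Summable.of_nonneg_of_le (fun k => by positivity) (fun k => ?_)
    ((summable_pow_mul_geometric_of_norm_lt_one n (r := (1 / 2 : ℝ)) (by norm_num)).mul_left A)
  calc (k : ℝ) ^ n * |u k| ≤ (k : ℝ) ^ n * (A * (1 / 2) ^ k) := by gcongr; exact hu k
    _ = A * ((k : ℝ) ^ n * (1 / 2) ^ k) := by ring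

lemma norm_mul_cos_le (c x : ℝ) : ‖c * cos x‖ ≤ |c| := by
  rw [norm_mul]
  exact mul_le_of_le_one_right (norm_nonneg _) (abs_cos_le_one x)

lemma hasSum_cosSeries {u : ℕ → ℝ} (hu : Summable fun k => |u k|) (θ z : ℝ) :
    HasSum (fun k : ℕ => u k * cos (k * z + θ)) (cosSeries u θ z) :=
  (Summable.of_norm_bounded hu fun k => norm_mul_cos_le (u k) (k * z + θ)).hasSum

lemma abs_cosSeries_le {u : ℕ → ℝ} (hu : Summable fun k => |u k|) (θ z : ℝ) :
    |cosSeries u θ z| ≤ ∑' k, |u k| :=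
  tsum_of_norm_bounded (f := fun k : ℕ => u k * cos (k * z + θ)) hu.hasSum fun _ =>
    norm_mul_cos_le _ _

lemma hasDerivAt_cosSeries {u : ℕ → ℝ} (hu : ∀ n : ℕ, Summable fun k : ℕ => (k : ℝ) ^ n * |u k|)
    (θ z : ℝ) :
    HasDerivAt (cosSeries u θ) (cosSeries (fun k => k * u k) (θ + π / 2) z) z := by
  refine hasDerivAt_tsum (g := fun k y => u k * cos (k * y + θ))
    (g' := fun k y => k * u k * cos (k * y + (θ + π / 2)))
    (u := fun k : ℕ => (k : ℝ) ^ 1 * |u k|) (y₀ := 0) (hu 1) (fun k y => ?_) (fun k y => ?_) ?_ z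
  · have h := ((((hasDerivAt_id y).const_mul (k : ℝ)).add_const θ).cos).const_mul (u k)
    refine h.congr_deriv ?_
    rw [← add_assoc, cos_add_pi_div_two]
    simp only [id]
    ring
  · refine (norm_mul_cos_le _ _).trans_eq ?_
    rw [abs_mul, Nat.abs_cast, pow_one]
  · exact (hasSum_cosSeries (by simpa using hu 0) θ 0).summable

lemma summable_pow_mul_natCast_mul {u : ℕ → ℝ}
    (hu : ∀ n : ℕ, Summable fun k : ℕ => (k : ℝ) ^ n * |u k|) (n : ℕ) :
    Summable fun k : ℕ => (k : ℝ) ^ n * |k * u k| := by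
  refine (hu (n + 1)).congr fun k => ?_
  rw [abs_mul, Nat.abs_cast]
  ring

lemma iteratedDeriv_cosSeries (n : ℕ) {u : ℕ → ℝ}
    (hu : ∀ n : ℕ, Summable fun k : ℕ => (k : ℝ) ^ n * |u k|) (θ : ℝ) :
    iteratedDeriv n (cosSeries u θ)
      = cosSeries (fun k => (k : ℝ) ^ n * u k) (θ + n * (π / 2)) := by
  induction n generalizing u θ with
  | zero => simp
  | succ n ih =>
    have hd : deriv (cosSeries u θ) = cosSeries (fun k => k * u k) (θ + π / 2) :=
      funext fun z => (hasDerivAt_cosSeries hu θ z).deriv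
    rw [iteratedDeriv_succ', hd, ih (summable_pow_mul_natCast_mul hu)]
    congr 1
    · funext k
      ring
    · push_cast
      ring

lemma contDiff_cosSeries {u : ℕ → ℝ}
    (hu : ∀ n : ℕ, Summable fun k : ℕ => (k : ℝ) ^ n * |u k|) (θ : ℝ) :
    ContDiff ℝ (⊤ : ℕ∞) (cosSeries u θ) := by
  refine contDiff_of_differentiable_iteratedDeriv fun m _ => ?_
  rw [iteratedDeriv_cosSeries m hu]
  intro z
  refine (hasDerivAt_cosSeries (fun n => ?_) _ z).differentiableAt
  refine (hu (n + m)).congr fun k => ?_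
  rw [abs_mul, abs_pow, Nat.abs_cast]
  ring

/-- Weights turning the mode equations into the differentiated equation at the point `z`. -/
noncomputable def modeWeight (τ z : ℝ) (k : ℕ) : ℝ :=
  if k = 0 then τ * cos z / 12 else ((k : ℝ) ^ 2 - 1) * τ ^ k * cos (k * z)

lemma modeMultiplier_mul_modeWeight (τ z : ℝ) {k : ℕ} (hk : 2 ≤ k) :
    modeMultiplier k * modeWeight τ z k = (k : ℝ) ^ 2 * τ ^ k * cos (k * z) := by
  rw [modeWeight, if_neg (by omega)]
  linear_combination τ ^ k * cos (k * z) * modeMultiplier_mul_sub_one (by omega : k ≠ 1)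

lemma sq_mul_pow_le {τ : ℝ} (hτ : |τ| ≤ 1 / 2) (k : ℕ) : (k : ℝ) ^ 2 * |τ| ^ k ≤ 9 / 4 := by
  have h1 : (k : ℝ) ^ 2 * |τ| ^ k ≤ (k : ℝ) ^ 2 * (1 / 2) ^ k := by gcongr
  refine h1.trans ?_
  rcases Nat.lt_or_ge k 3 with hk | hk
  · interval_cases k <;> norm_num
  · induction k, hk using Nat.le_induction with
    | base => norm_num
    | succ k hk ih =>
      have h3 : (3 : ℝ) ≤ k := by exact_mod_cast hk
      have h4 : ((k : ℝ) + 1) ^ 2 ≤ 2 * (k : ℝ) ^ 2 := by nlinarith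
      have h5 : (0 : ℝ) < (1 / 2) ^ k := by positivity
      have h6 := ih (by gcongr)
      push_cast
      rw [pow_succ (1 / 2 : ℝ) k]
      nlinarith

lemma abs_modeWeight_le {τ : ℝ} (hτ : |τ| ≤ 1 / 2) (z : ℝ) (k : ℕ) :
    |modeWeight τ z k| ≤ 9 / 4 := by
  unfold modeWeight
  split_ifs with h
  · have h1 := norm_mul_cos_le τ z
    rw [norm_eq_abs] at h1
    rw [abs_div, abs_of_pos (by norm_num : (0 : ℝ) < 12)]
    linarith
  · refine (norm_mul_cos_le _ _).trans ((?_ : _ ≤ _).trans (sq_mul_pow_le hτ k))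
    have h1 : (1 : ℝ) ≤ k := by exact_mod_cast Nat.one_le_iff_ne_zero.mpr h
    rw [abs_mul, abs_pow, abs_of_nonneg (by nlinarith)]
    gcongr
    linarith

lemma modeInteraction_modeWeight (τ z : ℝ) {j l : ℕ} (hj : j ≠ 0) (hl : l ≠ 0) :
    modeInteraction (τ ^ 2) (modeWeight τ z) j l
      = τ ^ j * τ ^ l * (((j : ℝ) ^ 2 + (l : ℝ) ^ 2) / 2 * (cos (j * z) * cos (l * z))
        - (j * l : ℝ) * (sin (j * z) * sin (l * z))) := by
  have hsum := modeMultiplier_mul_modeWeight τ z (k := j + l) (by omega)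
  have hdiff : ∀ n, modeMultiplier n / 4 * modeWeight τ z n
      + (if n = 1 then 3 else 0) * modeWeight τ z 0 = (n : ℝ) ^ 2 * τ ^ n * cos (n * z) / 4 := by
    intro n
    rcases Nat.lt_or_ge n 2 with h | h
    · interval_cases n
      · simp [modeMultiplier]
      · simp [modeMultiplier, modeWeight]
        ring
    · rw [if_neg (by omega), ← modeMultiplier_mul_modeWeight τ z h]
      ring
  have hdist : ∃ n, Nat.dist j l = n ∧ (n : ℝ) ^ 2 = ((j : ℝ) - l) ^ 2 ∧
      cos (n * z) = cos (j * z - l * z) ∧ (τ ^ 2) ^ min j l * τ ^ n = τ ^ j * τ ^ l := by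
    rcases le_total j l with h | h
    · obtain ⟨n, rfl⟩ := Nat.exists_eq_add_of_le h
      refine ⟨n, by simp [Nat.dist], by push_cast; ring, ?_, ?_⟩
      · rw [← cos_neg]
        congr 1
        push_cast
        ring
      · rw [min_eq_left h]
        ring
    · obtain ⟨n, rfl⟩ := Nat.exists_eq_add_of_le h
      refine ⟨n, by simp [Nat.dist], by push_cast; ring, ?_, ?_⟩
      · congr 1
        push_cast
        ring
      · rw [min_eq_right h]
        ring
  obtain ⟨n, hn, hn2, hnc, hnt⟩ := hdist
  have hd := hdiff n
  rw [modeInteraction, if_neg hj, if_neg hl, hn]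
  simp only [smul_eq_mul]
  have e : ∀ A B : ℝ, (τ ^ 2) ^ min j l * modeMultiplier n / 4 * A
      + (if n = 1 then 3 * (τ ^ 2) ^ min j l else 0) * B
      = (τ ^ 2) ^ min j l * (modeMultiplier n / 4 * A + (if n = 1 then 3 else 0) * B) := by
    intro A B
    split_ifs <;> ring
  have e2 : cos (((j + l : ℕ) : ℝ) * z) = cos (j * z + l * z) := by
    push_cast
    ring_nf
  rw [e, hd, hnc, hn2]
  rw [e2, cos_add, pow_add] at hsum
  push_cast at hsum
  rw [cos_sub]
  linear_combination (1 / 4) * hsum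
    + ((j : ℝ) - l) ^ 2 * (cos (j * z) * cos (l * z) + sin (j * z) * sin (l * z)) / 4 * hnt

lemma hasSum_mul_prod {f g : ℕ → ℝ} {s t : ℝ} (hf : HasSum f s) (hg : HasSum g t) :
    HasSum (fun p : ℕ × ℕ => f p.1 * g p.2) (s * t) :=
  hf.mul hg (summable_mul_of_summable_norm hf.summable.norm hg.summable.norm)

/-- The weak form of the mode equations yields the expanded travelling wave equation. -/
lemma ostrovsky_of_modes {τ : ℝ} (hτ : |τ| ≤ 1 / 2) {w : ℕ → ℝ}
    (hw1 : w 1 = 1 / 24)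
    (hw : ∀ (φ : ℕ → ℝ) (M S : ℝ), (∀ k, |φ k| ≤ M) → HasSum (fun k => w k * φ k) S →
        HasSum (fun p : ℕ × ℕ => w p.1 * w p.2 * modeInteraction (τ ^ 2) φ p.1 p.2)
          (S - φ 1 / 24)) {u : ℕ → ℝ} (hu : ∀ k, u k = if k = 0 then 0 else w k * τ ^ k)
    {z U V P : ℝ} (hU : HasSum (fun k : ℕ => u k * cos (k * z)) U)
    (hV : HasSum (fun k : ℕ => k * u k * sin (k * z)) V)
    (hP : HasSum (fun k : ℕ => (k : ℝ) ^ 2 * u k * cos (k * z)) P) :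
    (1 + 2 * w 0 - U) * P - U + V ^ 2 = 0 := by
  have hS : HasSum (fun k => w k * modeWeight τ z k) (w 0 * (τ * cos z / 12) + (P - U)) := by
    refine ((hasSum_ite_eq (0 : ℕ) (w 0 * (τ * cos z / 12))).add (hP.sub hU)).congr_fun ?_
    intro k
    rw [hu, modeWeight]
    split_ifs with h
    · simp [h]
    · ring
  have h1 := hw _ _ _ (abs_modeWeight_le hτ z) hS
  have hX := hasSum_ite_eq (0 : ℕ) (w 0)
  have hY := (hP.sub (hasSum_ite_eq (1 : ℕ) (τ * cos z / 24))).mul_left (-2)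
  have h2 := (hasSum_mul_prod hX hY).add ((((hasSum_mul_prod hP hU).add
    (hasSum_mul_prod hU hP)).mul_left (1 / 2)).sub (hasSum_mul_prod hV hV))
  have h3 := h1.unique (h2.congr_fun ?_)
  · have h4 : modeWeight τ z 1 = 0 := by simp [modeWeight]
    rw [h4] at h3
    linear_combination h3
  · rintro ⟨j, l⟩
    by_cases hj : j = 0
    · subst hj
      simp only [modeInteraction, if_true, hu, smul_eq_mul]
      rcases Nat.lt_or_ge l 2 with h | h
      · interval_cases l
        · simp [modeMultiplier]
        · simp only [modeMultiplier, hw1]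
          norm_num
          right
          ring
      · have h5 := modeMultiplier_mul_modeWeight τ z h
        rw [if_neg (by omega : l ≠ 1), if_neg (by omega : l ≠ 0)]
        simp only [Nat.cast_zero, zero_mul, mul_zero]
        linear_combination (-2 * w 0 * w l) * h5
    · by_cases hl : l = 0
      · subst hl
        simp [modeInteraction, hj, hu]
      · simp only [modeInteraction_modeWeight τ z hj hl, hu, if_neg hj, if_neg hl]
        ring

lemma hasSum_mul_ite_prod (w : ℕ → ℝ) (j l : ℕ) (c : ℝ) :
    HasSum (fun p : ℕ × ℕ => w p.1 * w p.2 * if p.1 = j ∧ p.2 = l then c else 0)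
      (w j * w l * c) := by
  convert hasSum_ite_eq (j, l) (w j * w l * c) using 2 with p
  obtain ⟨a, b⟩ := p
  by_cases h : a = j ∧ b = l
  · obtain ⟨rfl, rfl⟩ := h
    simp
  · simp [h]

lemma abs_le_of_hasSum_mul_mul {w : ℕ → ℝ} (hw : Summable fun k => |w k|) {R : ℝ}
    (hR : ∑' k, |w k| ≤ R) {h : ℕ → ℕ → ℝ} {M S : ℝ} (hM : ∀ j l, |h j l| ≤ M)
    (hS : HasSum (fun p : ℕ × ℕ => w p.1 * w p.2 * h p.1 p.2) S) : |S| ≤ R ^ 2 * M := by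
  have hM0 : 0 ≤ M := (abs_nonneg _).trans (hM 0 0)
  have hR0 : 0 ≤ ∑' k, |w k| := tsum_nonneg fun _ => abs_nonneg _
  have h1 := (hasSum_mul_prod hw.hasSum hw.hasSum).mul_right M
  rw [← hS.tsum_eq]
  refine (tsum_of_norm_bounded (f := fun p : ℕ × ℕ => w p.1 * w p.2 * h p.1 p.2) h1
    fun p => ?_).trans ?_
  · rw [norm_mul, norm_mul]
    exact mul_le_mul_of_nonneg_left (hM _ _) (by positivity)
  · gcongr
    nlinarith

lemma modeMultiplier_eq {m : ℕ} {c : ℝ} (h : (m : ℝ) ^ 2 / ((m : ℝ) ^ 2 - 1) = c) :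
    modeMultiplier m = c := h

/-- Leading-order behaviour of the low modes. -/
lemma abs_low_modes_sub_le {t : ℝ} (ht0 : 0 ≤ t) (ht1 : t ≤ 1) {w : ℕ → ℝ}
    (hws : Summable fun k => |w k|) (hR : ∑' k, |w k| ≤ 1 / 12) (hw1 : w 1 = 1 / 24)
    (hw : ∀ (φ : ℕ → ℝ) (M S : ℝ), (∀ k, |φ k| ≤ M) → HasSum (fun k => w k * φ k) S →
        HasSum (fun p : ℕ × ℕ => w p.1 * w p.2 * modeInteraction t φ p.1 p.2)
          (S - φ 1 / 24)) :
    |w 0 - t / 6912| ≤ t ^ 2 / 40 ∧ |w 2 - 1 / 1728| ≤ t / 100 ∧ |w 3 - 1 / 73728| ≤ t / 100 := by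
  have hwle : ∀ k, |w k| ≤ 1 / 12 := fun k =>
    (hws.le_tsum k fun _ _ => abs_nonneg _).trans hR
  have hcoord : ∀ i, i ≠ 1 → HasSum (fun p : ℕ × ℕ => w p.1 * w p.2 *
      modeInteraction t (fun k => if k = i then (1 : ℝ) else 0) p.1 p.2) (w i) := by
    intro i hi
    have h1 : HasSum (fun k => w k * if k = i then (1 : ℝ) else 0) (w i) := by
      refine (hasSum_ite_eq i (w i)).congr_fun fun k => ?_
      by_cases h : k = i <;> simp [h]
    have := hw _ 1 _ (fun k => by split_ifs <;> simp) h1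
    simpa [hi.symm] using this
  have m0 : modeMultiplier 0 = 0 := modeMultiplier_eq (by norm_num)
  have m2 : modeMultiplier 2 = 4 / 3 := modeMultiplier_eq (by norm_num)
  have m3 : modeMultiplier 3 = 9 / 8 := modeMultiplier_eq (by norm_num)
  have hpow : ∀ j l n : ℕ, n ≤ j → n ≤ l → t ^ min j l ≤ t ^ n := fun j l n hj hl =>
    pow_le_pow_of_le_one ht0 ht1 (le_min hj hl)
  have hpow0 : ∀ j l : ℕ, 0 ≤ t ^ min j l := fun j l => by positivity
  have k0 : ∀ j l : ℕ, modeInteraction t (fun k => if k = 0 then (1 : ℝ) else 0) j l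
      = if j ≠ 0 ∧ l ≠ 0 ∧ (j = l + 1 ∨ l = j + 1) then 3 * t ^ min j l else 0 := by
    intro j l
    by_cases hj : j = 0
    · by_cases hl : l = 0 <;> simp [modeInteraction, hj, hl, m0]
    by_cases hl : l = 0
    · simp [modeInteraction, hj, hl]
    have hd : Nat.dist j l = 1 ↔ (j = l + 1 ∨ l = j + 1) := by
      unfold Nat.dist
      omega
    by_cases hd0 : Nat.dist j l = 0 <;> simp [modeInteraction, hj, hl, hd0, ← hd, m0]
  have k2 : ∀ i j l : ℕ, i ≠ 0 → modeInteraction t (fun k => if k = i then (1 : ℝ) else 0) j l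
      = (if j = 0 ∧ l = i then -2 * modeMultiplier i else 0)
        + (if j ≠ 0 ∧ l ≠ 0 ∧ j + l = i then modeMultiplier i / 4 else 0)
        + (if j ≠ 0 ∧ l ≠ 0 ∧ (j = l + i ∨ l = j + i) then t ^ min j l * modeMultiplier i / 4
          else 0) := by
    intro i j l hi
    by_cases hj : j = 0
    · by_cases hl : l = i <;> simp [modeInteraction, hj, hl]
    by_cases hl : l = 0
    · simp [modeInteraction, hj, hl]
    have hd : Nat.dist j l = i ↔ (j = l + i ∨ l = j + i) := by
      unfold Nat.dist
      omega
    by_cases hd0 : Nat.dist j l = i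
    · by_cases hs : j + l = i <;> simp [modeInteraction, hj, hl, hs, hd0, ← hd, hi.symm]
    · by_cases hs : j + l = i <;> simp [modeInteraction, hj, hl, hs, hd0, ← hd, hi.symm]
  have h0 : |w 0| ≤ t / 48 := by
    refine (abs_le_of_hasSum_mul_mul hws hR (M := 3 * t) (fun j l => ?_)
      (hcoord 0 (by norm_num))).trans_eq (by ring)
    rw [k0]
    split_ifs with h
    · rw [abs_of_nonneg (by positivity)]
      linarith [hpow j l 1 (by omega) (by omega)]
    · simpa using ht0
  have h0' : |w 0 - 6 * t * (w 1 * w 2)| ≤ t ^ 2 / 48 := by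
    have hs := ((hcoord 0 (by norm_num)).sub (hasSum_mul_ite_prod w 1 2 (3 * t))).sub
      (hasSum_mul_ite_prod w 2 1 (3 * t))
    have hs' := abs_le_of_hasSum_mul_mul hws hR (M := 3 * t ^ 2) (h := fun j l =>
      modeInteraction t (fun k => if k = 0 then (1 : ℝ) else 0) j l
        - (if j = 1 ∧ l = 2 then 3 * t else 0) - (if j = 2 ∧ l = 1 then 3 * t else 0))
      (fun j l => ?_) (hs.congr_fun fun p => by ring)
    · convert hs' using 1
      · congr 1
        ring
      · ring
    · rw [k0]
      by_cases h12 : j = 1 ∧ l = 2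
      · simpa [h12] using sq_nonneg t
      by_cases h21 : j = 2 ∧ l = 1
      · simpa [h21] using sq_nonneg t
      rw [if_neg h12, if_neg h21, sub_zero, sub_zero]
      split_ifs with h
      · rw [abs_of_nonneg (by positivity)]
        linarith [hpow j l 2 (by omega) (by omega)]
      · simpa using sq_nonneg t
  have h2 : |w 2 - w 1 ^ 2 / 3 + 8 / 3 * (w 0 * w 2)| ≤ t / 432 := by
    have hs := ((hcoord 2 (by norm_num)).sub (hasSum_mul_ite_prod w 1 1 (1 / 3))).sub
      (hasSum_mul_ite_prod w 0 2 (-8 / 3))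
    have hs' := abs_le_of_hasSum_mul_mul hws hR (M := t / 3) (h := fun j l =>
      modeInteraction t (fun k => if k = 2 then (1 : ℝ) else 0) j l
        - (if j = 1 ∧ l = 1 then 1 / 3 else 0) - (if j = 0 ∧ l = 2 then -8 / 3 else 0))
      (fun j l => ?_) (hs.congr_fun fun p => by ring)
    · convert hs' using 1
      · congr 1
        ring
      · ring
    · have e1 : (j ≠ 0 ∧ l ≠ 0 ∧ j + l = 2) ↔ (j = 1 ∧ l = 1) := by omega
      rw [k2 2 j l (by norm_num), m2, if_congr e1 rfl rfl]
      have e2 : ∀ x y z : ℝ, x + y + z - y - x = z := fun x y z => by ring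
      norm_num only
      rw [e2]
      split_ifs with h
      · rw [abs_of_nonneg (by positivity)]
        linarith [hpow j l 1 (by omega) (by omega)]
      · rw [abs_zero]
        positivity
  have h3 : |w 3 - 9 / 16 * (w 1 * w 2) + 9 / 4 * (w 0 * w 3)| ≤ t / 432 := by
    have hs := (((hcoord 3 (by norm_num)).sub (hasSum_mul_ite_prod w 1 2 (9 / 32))).sub
      (hasSum_mul_ite_prod w 2 1 (9 / 32))).sub (hasSum_mul_ite_prod w 0 3 (-9 / 4))
    have hs' := abs_le_of_hasSum_mul_mul hws hR (M := t / 3) (h := fun j l =>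
      modeInteraction t (fun k => if k = 3 then (1 : ℝ) else 0) j l
        - (if j = 1 ∧ l = 2 then 9 / 32 else 0) - (if j = 2 ∧ l = 1 then 9 / 32 else 0)
        - (if j = 0 ∧ l = 3 then -9 / 4 else 0))
      (fun j l => ?_) (hs.congr_fun fun p => by ring)
    · convert hs' using 1
      · congr 1
        ring
      · ring
    · have e1 : (if j ≠ 0 ∧ l ≠ 0 ∧ j + l = 3 then (9 / 8 / 4 : ℝ) else 0)
          = (if j = 1 ∧ l = 2 then 9 / 32 else 0) + (if j = 2 ∧ l = 1 then 9 / 32 else 0) := by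
        split_ifs <;> first | omega | norm_num
      rw [k2 3 j l (by norm_num), m3, e1]
      have e2 : ∀ x y y' z : ℝ, x + (y + y') + z - y - y' - x = z := fun x y y' z => by ring
      norm_num only
      rw [e2]
      split_ifs with h
      · rw [abs_of_nonneg (by positivity)]
        linarith [hpow j l 1 (by omega) (by omega), hpow0 j l]
      · rw [abs_zero]
        positivity
  have h02 : |w 0 * w 2| ≤ t / 48 * (1 / 12) := by
    rw [abs_mul]
    exact mul_le_mul h0 (hwle 2) (abs_nonneg _) (by positivity)
  have h03 : |w 0 * w 3| ≤ t / 48 * (1 / 12) := by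
    rw [abs_mul]
    exact mul_le_mul h0 (hwle 3) (abs_nonneg _) (by positivity)
  rw [hw1] at h0' h2 h3
  rw [abs_le] at h0' h2 h3 h02 h03
  have e2 : |w 2 - 1 / 1728| ≤ t / 100 := by
    rw [abs_le]
    constructor <;> linarith
  refine ⟨?_, e2, ?_⟩
  · rw [abs_le] at e2 ⊢
    constructor <;> nlinarith
  · rw [abs_le] at e2 ⊢
    constructor <;> linarith

/-- The first three Fourier coefficients of the Stokes wave of amplitude `a`, to third order. -/
noncomputable def stokesCoeff (a : ℝ) (k : ℕ) : ℝ :=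
  if k = 1 then a else if k = 2 then a ^ 2 / 3 else if k = 3 then 3 * a ^ 3 / 16 else 0

lemma hasSum_stokesCoeff (a z : ℝ) :
    HasSum (fun k : ℕ => stokesCoeff a k * cos (k * z))
      (a * cos z + a ^ 2 / 3 * cos (2 * z) + 3 * a ^ 3 / 16 * cos (3 * z)) := by
  refine (((hasSum_ite_eq 1 (a * cos z)).add (hasSum_ite_eq 2 (a ^ 2 / 3 * cos (2 * z)))).add
    (hasSum_ite_eq 3 (3 * a ^ 3 / 16 * cos (3 * z)))).congr_fun fun k => ?_
  unfold stokesCoeff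
  by_cases h1 : k = 1
  · simp [h1]
  by_cases h2 : k = 2
  · simp [h2]
  by_cases h3 : k = 3
  · simp [h3]
  simp [h1, h2, h3]

lemma exists_stokes_coefficients {a : ℝ} (ha : |a| ≤ 1 / 48) :
    ∃ (g : ℝ) (u : ℕ → ℝ), |g - 1 - a ^ 2 / 6| ≤ 20000 * a ^ 4 ∧
      (∀ k, |u k| ≤ (1 / 2) ^ k) ∧
      (∀ k, |u k - stokesCoeff a k| ≤ 1000000 * a ^ 4 * (1 / 2) ^ k) ∧
      ∀ z U V P : ℝ, HasSum (fun k : ℕ => u k * cos (k * z)) U →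
        HasSum (fun k : ℕ => k * u k * sin (k * z)) V →
        HasSum (fun k : ℕ => (k : ℝ) ^ 2 * u k * cos (k * z)) P →
        (g - U) * P - U + V ^ 2 = 0 := by
  obtain ⟨τ, rfl⟩ : ∃ τ, a = τ / 24 := ⟨24 * a, by ring⟩
  have hτ : |τ| ≤ 1 / 2 := by
    rw [abs_div, abs_of_pos (by norm_num : (0 : ℝ) < 24)] at ha
    linarith
  have ht0 : 0 ≤ τ ^ 2 := sq_nonneg τ
  have hτ2 : |τ| ^ 2 = τ ^ 2 := sq_abs τ
  have ht1 : τ ^ 2 ≤ 1 := by nlinarith [abs_nonneg τ]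
  obtain ⟨w, hws, hR, hw⟩ := exists_modes ht0 ht1
  have hw1 : w 1 = 1 / 24 := by
    have h1 : HasSum (fun k => w k * if k = 1 then (1 : ℝ) else 0) (w 1) := by
      refine (hasSum_ite_eq 1 (w 1)).congr_fun fun k => ?_
      by_cases h : k = 1 <;> simp [h]
    have h2 := hw _ 1 _ (fun k => by split_ifs <;> simp) h1
    have h3 : ∀ j l, modeInteraction (τ ^ 2) (fun k => if k = 1 then (1 : ℝ) else 0) j l = 0 := by
      have m1 : modeMultiplier 1 = 0 := modeMultiplier_eq (by norm_num)
      intro j l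
      have e : ∀ (c : ℝ) (k : ℕ), c * modeMultiplier k * (if k = 1 then (1 : ℝ) else 0) = 0 := by
        intro c k
        split_ifs with h <;> simp [h, m1]
      unfold modeInteraction
      split_ifs
      · exact e _ _
      · rfl
      all_goals
        simp only [smul_eq_mul, zero_ne_one, if_false]
        linear_combination e (1 / 4) (j + l)
          + e ((τ ^ 2) ^ min j l / 4) (Nat.dist j l)
    simp only [h3, mul_zero, if_true] at h2
    linarith [h2.unique hasSum_zero]
  have hwle : ∀ k, |w k| ≤ 1 / 12 := fun k =>
    (hws.le_tsum k fun _ _ => abs_nonneg _).trans hR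
  obtain ⟨hl0, hl2, hl3⟩ := abs_low_modes_sub_le ht0 ht1 hws hR hw1 hw
  refine ⟨1 + 2 * w 0, fun k => if k = 0 then 0 else w k * τ ^ k, ?_, fun k => ?_, fun k => ?_,
    fun z U V P hU hV hP => ostrovsky_of_modes hτ hw1 hw (fun k => rfl) hU hV hP⟩
  · rw [abs_le] at hl0 ⊢
    constructor <;> nlinarith
  · beta_reduce
    split_ifs
    · rw [abs_zero]
      positivity
    · rw [abs_mul, abs_pow]
      have : |τ| ^ k ≤ (1 / 2) ^ k := by gcongr
      nlinarith [hwle k, abs_nonneg (w k), pow_nonneg (abs_nonneg τ) k]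
  · beta_reduce
    have hτ4 : 0 ≤ τ ^ 4 := by positivity
    rcases Nat.lt_or_ge k 4 with hk | hk
    · interval_cases k
      · simp [stokesCoeff]
        positivity
      · simp [stokesCoeff, hw1]
        rw [show 24⁻¹ * τ - τ / 24 = 0 by ring, abs_zero]
        positivity
      · have e : w 2 * τ ^ 2 - (τ / 24) ^ 2 / 3 = (w 2 - 1 / 1728) * τ ^ 2 := by ring
        simp only [stokesCoeff]
        norm_num only [if_true, if_false]
        rw [e, abs_mul, abs_of_nonneg ht0]
        nlinarith
      · have e : w 3 * τ ^ 3 - 3 * (τ / 24) ^ 3 / 16 = (w 3 - 1 / 73728) * τ ^ 2 * τ := by ring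
        simp only [stokesCoeff]
        norm_num only [if_true, if_false]
        rw [e, abs_mul, abs_mul, abs_of_nonneg ht0]
        have h1 : |w 3 - 1 / 73728| * τ ^ 2 ≤ τ ^ 4 / 100 := by nlinarith
        have h2 : |w 3 - 1 / 73728| * τ ^ 2 * |τ| ≤ τ ^ 4 / 100 * (1 / 2) := by gcongr
        linarith
    · obtain ⟨m, rfl⟩ := Nat.exists_eq_add_of_le hk
      rw [stokesCoeff, if_neg (by omega), if_neg (by omega), if_neg (by omega),
        if_neg (by omega), sub_zero, abs_mul, abs_pow, pow_add, pow_add]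
      have h1 : |τ| ^ m ≤ (1 / 2) ^ m := by gcongr
      have h2 : |τ| ^ 4 = τ ^ 4 := by rw [← abs_pow, abs_of_nonneg hτ4]
      rw [h2]
      calc |w (4 + m)| * (τ ^ 4 * |τ| ^ m) ≤ 1 / 12 * (τ ^ 4 * (1 / 2) ^ m) := by
            gcongr
            exact hwle _
        _ ≤ 1000000 * (τ / 24) ^ 4 * ((1 / 2) ^ 4 * (1 / 2) ^ m) := by
            have : 0 ≤ τ ^ 4 * (1 / 2 : ℝ) ^ m := by positivity
            nlinarith

lemma abs_invariant_sub_le {a g U : ℝ} (ha : |a| ≤ 1) {C D : ℝ} (hD : 0 ≤ D)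
    (hU : |U - a - a ^ 2 / 3| ≤ C * |a| ^ 3) (hg : |g - 1| ≤ D * a ^ 2) :
    |g / 2 * U ^ 2 - 1 / 3 * U ^ 3 - a ^ 2 / 2|
      ≤ (C + (1 / 3 + C) ^ 2 / 2 + D / 2 * (1 + (1 / 3 + C)) ^ 2 + (1 / 3 + C)
        + (1 / 3 + C) ^ 2 + (1 / 3 + C) ^ 3 / 3) * a ^ 4 := by
  rcases eq_or_ne a 0 with rfl | h0
  · have : U = 0 := by simpa using hU
    simp [this]
  have ha0 : 0 < |a| := abs_pos.mpr h0
  obtain ⟨q, rfl⟩ : ∃ q, U = a + a ^ 2 / 3 + a ^ 3 * q :=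
    ⟨(U - a - a ^ 2 / 3) / a ^ 3, by field_simp; ring⟩
  obtain ⟨p, rfl⟩ : ∃ p, g = 1 + a ^ 2 * p := ⟨(g - 1) / a ^ 2, by field_simp; ring⟩
  have hq : |q| ≤ C := by
    rw [show a + a ^ 2 / 3 + a ^ 3 * q - a - a ^ 2 / 3 = a ^ 3 * q by ring, abs_mul, abs_pow,
      mul_comm] at hU
    exact le_of_mul_le_mul_right hU (by positivity)
  have hp : |p| ≤ D := by
    rw [show 1 + a ^ 2 * p - 1 = a ^ 2 * p by ring, abs_mul, abs_pow, sq_abs, mul_comm] at hg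
    exact le_of_mul_le_mul_right hg (by positivity)
  obtain ⟨v, hv⟩ : ∃ v, v = 1 / 3 + a * q := ⟨_, rfl⟩
  have hvV : |v| ≤ 1 / 3 + C := by
    rw [hv]
    refine (abs_add_le _ _).trans ?_
    rw [abs_mul, abs_of_pos (by norm_num : (0 : ℝ) < 1 / 3)]
    nlinarith [abs_nonneg q]
  have e : (1 + a ^ 2 * p) / 2 * (a + a ^ 2 / 3 + a ^ 3 * q) ^ 2
      - 1 / 3 * (a + a ^ 2 / 3 + a ^ 3 * q) ^ 3 - a ^ 2 / 2
      = (q + v ^ 2 / 2 + p / 2 * (1 + a * v) ^ 2 - v - a * v ^ 2 - a ^ 2 * v ^ 3 / 3) * a ^ 4 := by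
    rw [hv]
    ring
  rw [e, abs_mul, abs_of_nonneg (by positivity : 0 ≤ a ^ 4)]
  gcongr
  have b2 : |v| ^ 2 ≤ (1 / 3 + C) ^ 2 := by gcongr
  have b3 : |v| ^ 3 ≤ (1 / 3 + C) ^ 3 := by gcongr
  have t1 : |v ^ 2 / 2| ≤ (1 / 3 + C) ^ 2 / 2 := by
    rw [abs_div, abs_pow, abs_two]
    gcongr
  have t2 : |p / 2 * (1 + a * v) ^ 2| ≤ D / 2 * (1 + (1 / 3 + C)) ^ 2 := by
    have : |1 + a * v| ≤ 1 + (1 / 3 + C) := by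
      refine (abs_add_le _ _).trans ?_
      rw [abs_one, abs_mul]
      nlinarith [abs_nonneg v]
    rw [abs_mul, abs_div, abs_pow, abs_two]
    gcongr
  have t3 : |a * v ^ 2| ≤ (1 / 3 + C) ^ 2 := by
    rw [abs_mul, abs_pow]
    nlinarith [sq_nonneg |v|]
  have t4 : |a ^ 2 * v ^ 3 / 3| ≤ (1 / 3 + C) ^ 3 / 3 := by
    rw [abs_div, abs_mul, abs_pow, abs_pow, abs_of_pos (three_pos : (0 : ℝ) < 3)]
    have : |a| ^ 2 ≤ 1 := pow_le_one₀ ha0.le ha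
    have : 0 ≤ |v| ^ 3 := by positivity
    have : |a| ^ 2 * |v| ^ 3 ≤ 1 * (1 / 3 + C) ^ 3 := by gcongr
    linarith
  rw [abs_le] at *
  constructor <;> linarith [hq.1, hq.2, hvV.1, hvV.2, t1.1, t1.2, t2.1, t2.2, t3.1, t3.2,
    t4.1, t4.2]

lemma invariant_eq_of_ostrovsky {U U' U'' : ℝ → ℝ} {g : ℝ} (h1 : ∀ z, HasDerivAt U (U' z) z)
    (h2 : ∀ z, HasDerivAt U' (U'' z) z)
    (h : ∀ z, (g - U z) * U'' z - U' z ^ 2 + U z = 0) (x y : ℝ) :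
    1 / 2 * (g - U x) ^ 2 * U' x ^ 2 + g / 2 * U x ^ 2 - 1 / 3 * U x ^ 3
      = 1 / 2 * (g - U y) ^ 2 * U' y ^ 2 + g / 2 * U y ^ 2 - 1 / 3 * U y ^ 3 := by
  have hd : ∀ z, HasDerivAt (fun z => 1 / 2 * (g - U z) ^ 2 * U' z ^ 2 + g / 2 * U z ^ 2
      - 1 / 3 * U z ^ 3) 0 z := by
    intro z
    have := ((((((h1 z).const_sub g).pow 2).const_mul (1 / 2)).mul ((h2 z).pow 2)).add
      (((h1 z).pow 2).const_mul (g / 2))).sub (((h1 z).pow 3).const_mul (1 / 3))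
    refine this.congr_deriv ?_
    simp only [Pi.pow_apply]
    push_cast
    linear_combination ((g - U z) * U' z) * h z
  exact is_const_of_deriv_eq_zero (fun z => (hd z).differentiableAt) (fun z => (hd z).deriv) x y

theorem stokes_expansion_reduced_ostrovsky :
    ∃ a₀ > (0:ℝ), ∃ γ : ℝ → ℝ, ∃ U : ℝ → ℝ → ℝ, ∃ I : ℝ → ℝ,
      (∀ a : ℝ, |a| < a₀ →
        ContDiff ℝ (⊤ : ℕ∞) (U a) ∧ (∀ z : ℝ, U a (-z) = U a z) ∧
        Function.Periodic (U a) (2 * π) ∧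
        (∀ z : ℝ, deriv (fun w => (γ a - U a w) * deriv (U a) w) z + U a z = 0)) ∧
      (∀ n : ℕ, ∃ C > (0:ℝ), ∀ a : ℝ, |a| < a₀ → ∀ z : ℝ,
        |iteratedDeriv n
          (fun w => U a w - a * Real.cos w - (a ^ 2 / 3) * Real.cos (2 * w)
            - (3 * a ^ 3 / 16) * Real.cos (3 * w)) z| ≤ C * a ^ 4) ∧
      (∃ C > (0:ℝ), ∀ a : ℝ, |a| < a₀ → |γ a - 1 - a ^ 2 / 6| ≤ C * a ^ 4) ∧
      (∃ C > (0:ℝ), ∀ a : ℝ, |a| < a₀ →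
        (∀ z : ℝ,
          (1/2) * (γ a - U a z) ^ 2 * (deriv (U a) z) ^ 2
            + (γ a / 2) * (U a z) ^ 2 - (1/3) * (U a z) ^ 3 = I a) ∧
        |I a - a ^ 2 / 2| ≤ C * a ^ 4) := by
  have hex : ∀ a : ℝ, ∃ (g : ℝ) (u : ℕ → ℝ), |a| ≤ 1 / 48 →
      |g - 1 - a ^ 2 / 6| ≤ 20000 * a ^ 4 ∧
      (∀ k, |u k| ≤ (1 / 2) ^ k) ∧
      (∀ k, |u k - stokesCoeff a k| ≤ 1000000 * a ^ 4 * (1 / 2) ^ k) ∧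
      ∀ z U V P : ℝ, HasSum (fun k : ℕ => u k * cos (k * z)) U →
        HasSum (fun k : ℕ => k * u k * sin (k * z)) V →
        HasSum (fun k : ℕ => (k : ℝ) ^ 2 * u k * cos (k * z)) P →
        (g - U) * P - U + V ^ 2 = 0 := by
    intro a
    by_cases ha : |a| ≤ 1 / 48
    · obtain ⟨g, u, h⟩ := exists_stokes_coefficients ha
      exact ⟨g, u, fun _ => h⟩
    · exact ⟨0, 0, fun h => absurd h ha⟩
  choose γ u hu using hex
  have hdecay : ∀ a : ℝ, |a| ≤ 1 / 48 → ∀ n : ℕ, Summable fun k : ℕ => (k : ℝ) ^ n * |u a k| :=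
    fun a ha => summable_pow_mul_of_geometric_bound (A := 1)
      (fun k => by simpa using (hu a ha).2.1 k)
  have hrem_decay : ∀ a : ℝ, |a| ≤ 1 / 48 → ∀ n : ℕ,
      Summable fun k : ℕ => (k : ℝ) ^ n * |u a k - stokesCoeff a k| :=
    fun a ha => summable_pow_mul_of_geometric_bound (hu a ha).2.2.1
  have hrem : ∀ a : ℝ, |a| ≤ 1 / 48 →
      (fun w => cosSeries (u a) 0 w - a * Real.cos w - (a ^ 2 / 3) * Real.cos (2 * w)
        - (3 * a ^ 3 / 16) * Real.cos (3 * w)) = cosSeries (fun k => u a k - stokesCoeff a k) 0 := by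
    intro a ha
    funext z
    have h1 := hasSum_cosSeries (by simpa using hdecay a ha 0) 0 z
    have h2 := hasSum_cosSeries (by simpa using hrem_decay a ha 0) 0 z
    simp only [add_zero] at h1 h2
    have h3 := (h1.sub (hasSum_stokesCoeff a z)).congr_fun (g := fun k : ℕ =>
      (u a k - stokesCoeff a k) * cos (k * z)) fun k => by ring
    rw [← h3.unique h2]
    ring
  have hderiv : ∀ a : ℝ, |a| ≤ 1 / 48 → ∀ z, HasDerivAt (cosSeries (u a) 0)
      (cosSeries (fun k => k * u a k) (0 + π / 2) z) z := fun a ha z =>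
    hasDerivAt_cosSeries (hdecay a ha) 0 z
  have hderiv2 : ∀ a : ℝ, |a| ≤ 1 / 48 → ∀ z,
      HasDerivAt (cosSeries (fun k => k * u a k) (0 + π / 2))
      (cosSeries (fun k => k * (k * u a k)) (0 + π / 2 + π / 2) z) z := fun a ha z =>
    hasDerivAt_cosSeries (summable_pow_mul_natCast_mul (hdecay a ha)) _ z
  have hode : ∀ a : ℝ, |a| ≤ 1 / 48 → ∀ z, (γ a - cosSeries (u a) 0 z)
      * cosSeries (fun k => k * (k * u a k)) (0 + π / 2 + π / 2) z
      - cosSeries (fun k => k * u a k) (0 + π / 2) z ^ 2 + cosSeries (u a) 0 z = 0 := by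
    intro a ha z
    have hd1 := summable_pow_mul_natCast_mul (hdecay a ha)
    have h0 := hasSum_cosSeries (by simpa using hdecay a ha 0) 0 z
    have h1 := hasSum_cosSeries (u := fun k => k * u a k) (by simpa only [pow_zero, one_mul] using hd1 0) (0 + π / 2) z
    have h2 := hasSum_cosSeries (u := fun k => k * (k * u a k))
      (by simpa only [pow_zero, one_mul] using summable_pow_mul_natCast_mul hd1 0)
      (0 + π / 2 + π / 2) z
    have := (hu a ha).2.2.2 z _ _ _ (by simpa using h0) (h1.neg.congr_fun fun k => ?_)
      (h2.neg.congr_fun fun k => ?_)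
    · linear_combination -this
    · rw [zero_add, cos_add_pi_div_two]
      ring
    · rw [zero_add, add_halves, cos_add_pi]
      ring
  have hzero : ∀ a : ℝ, cosSeries (fun k => k * u a k) (0 + π / 2) 0 = 0 := fun a => by
    simp [cosSeries]
  refine ⟨1 / 48, by norm_num, γ, fun a => cosSeries (u a) 0, fun a =>
    γ a / 2 * cosSeries (u a) 0 0 ^ 2 - 1 / 3 * cosSeries (u a) 0 0 ^ 3, ?_, ?_, ?_, ?_⟩
  · intro a ha
    refine ⟨contDiff_cosSeries (hdecay a ha.le) 0, fun z => ?_, fun z => ?_, fun z => ?_⟩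
    · simp [cosSeries]
    · simp only [cosSeries, add_zero]
      refine tsum_congr fun k => ?_
      rw [mul_add, cos_add_nat_mul_two_pi]
    · have e : deriv (cosSeries (u a) 0) = cosSeries (fun k => k * u a k) (0 + π / 2) :=
        funext fun z => (hderiv a ha.le z).deriv
      have h := (((hderiv a ha.le z).const_sub (γ a)).mul (hderiv2 a ha.le z)).deriv
      rw [e]
      refine (congrArg (· + _) h).trans ?_
      linear_combination hode a ha.le z
  · intro n
    have hs : Summable fun k : ℕ => (k : ℝ) ^ n * (1 / 2 : ℝ) ^ k :=
      summable_pow_mul_geometric_of_norm_lt_one n (by norm_num)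
    have hs0 : 0 ≤ ∑' k : ℕ, (k : ℝ) ^ n * (1 / 2 : ℝ) ^ k := tsum_nonneg fun k => by positivity
    refine ⟨1000000 * (∑' k : ℕ, (k : ℝ) ^ n * (1 / 2 : ℝ) ^ k) + 1, by positivity,
      fun a ha z => ?_⟩
    have hsum : Summable fun k : ℕ => |(k : ℝ) ^ n * (u a k - stokesCoeff a k)| :=
      (hrem_decay a ha.le n).congr fun k => by rw [abs_mul, abs_pow, Nat.abs_cast]
    rw [hrem a ha.le, iteratedDeriv_cosSeries n (hrem_decay a ha.le)]
    refine (abs_cosSeries_le hsum _ z).trans ?_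
    have hle := hsum.tsum_le_tsum (fun k => ?_) (hs.mul_left (1000000 * a ^ 4))
    · rw [tsum_mul_left] at hle
      have : 0 ≤ a ^ 4 := by positivity
      linarith
    · rw [abs_mul, abs_pow, Nat.abs_cast]
      calc (k : ℝ) ^ n * |u a k - stokesCoeff a k|
          ≤ (k : ℝ) ^ n * (1000000 * a ^ 4 * (1 / 2) ^ k) := by
            gcongr
            exact (hu a ha.le).2.2.1 k
        _ = 1000000 * a ^ 4 * ((k : ℝ) ^ n * (1 / 2) ^ k) := by ring
  · exact ⟨20000, by norm_num, fun a ha => (hu a ha.le).1⟩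
  · refine ⟨_, ?_, fun a ha => ⟨fun z => ?_, abs_invariant_sub_le (C := 2000001) (D := 20001)
      (by linarith) (by norm_num) ?_ ?_⟩⟩
    · norm_num
    · rw [(hderiv a ha.le z).deriv, invariant_eq_of_ostrovsky (hderiv a ha.le) (hderiv2 a ha.le)
        (hode a ha.le) z 0, hzero a]
      ring
    · have hsum : Summable fun k : ℕ => |u a k - stokesCoeff a k| := by
        simpa using hrem_decay a ha.le 0
      have h1 := abs_cosSeries_le hsum 0 0
      have h2 : ∑' k, |u a k - stokesCoeff a k| ≤ 1000000 * a ^ 4 * 2 := by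
        rw [← tsum_geometric_two, ← tsum_mul_left]
        exact hsum.tsum_le_tsum (hu a ha.le).2.2.1 (summable_geometric_two.mul_left _)
      have h3 := congrFun (hrem a ha.le) 0
      simp only [mul_zero, cos_zero, mul_one] at h3
      rw [← h3] at h1
      have h4 : a ^ 4 ≤ |a| ^ 3 := by
        rw [← abs_of_nonneg (by positivity : 0 ≤ a ^ 4), abs_pow]
        exact pow_le_pow_of_le_one (abs_nonneg a) (by linarith) (by norm_num)
      have h5 : |3 * a ^ 3 / 16| ≤ |a| ^ 3 := by
        rw [abs_div, abs_mul, abs_pow]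
        norm_num
        linarith [pow_nonneg (abs_nonneg a) 3]
      have h6 := h1.trans h2
      rw [abs_le] at h5 h6 ⊢
      constructor <;> linarith [h5.1, h5.2, h6.1, h6.2]
    · have h1 := (hu a ha.le).1
      have h2 : a ^ 2 ≤ 1 := by
        rw [← sq_abs]
        exact pow_le_one₀ (abs_nonneg a) (by linarith)
      have h3 : a ^ 4 ≤ a ^ 2 := by nlinarith [sq_nonneg a]
      rw [abs_le] at h1 ⊢
      constructor <;> nlinarith [h1.1, h1.2, sq_nonneg a]
end

section
/- Let γ ∈ ℝ and let U : ℝ → ℝ be a C² solution of ((γ − U(z))·U'(z))' + U(z) = 0 on ℝ. Then the function I(z) = (1/2)(γ − U(z))²·U'(z)² + (γ/2)·U(z)² − (1/3)·U(z)³ is constant on ℝ; denoting its constant value by I, one has the pointwise identity (γ − U(z))³·(1 − 3U''(z)) = γ³ − 6I for every z ∈ ℝ at which U is twice differentiable. -/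
theorem first_order_invariant_reduced_ostrovsky
    (γ : ℝ) (U : ℝ → ℝ) (hU : ContDiff ℝ 2 U)
    (hODE : ∀ z : ℝ, deriv (fun w => (γ - U w) * deriv U w) z + U z = 0) :
    ∃ I : ℝ,
      (∀ z : ℝ,
        (1/2) * (γ - U z) ^ 2 * (deriv U z) ^ 2
          + (γ / 2) * (U z) ^ 2 - (1/3) * (U z) ^ 3 = I) ∧
      (∀ z : ℝ,
        (γ - U z) ^ 3 * (1 - 3 * iteratedDeriv 2 U z) = γ ^ 3 - 6 * I) := by
  have hU1 (z : ℝ) : HasDerivAt U (deriv U z) z :=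
    (hU.differentiable (by norm_num) z).hasDerivAt
  have hU2 (z : ℝ) : HasDerivAt (deriv U) (iteratedDeriv 2 U z) z := by
    have h := (hU.differentiable_iteratedDeriv 1 (by norm_num) z).hasDerivAt
    rwa [← iteratedDeriv_succ, iteratedDeriv_one] at h
  have ode (z : ℝ) : (γ - U z) * iteratedDeriv 2 U z - deriv U z ^ 2 + U z = 0 := by
    have h : HasDerivAt (fun w => (γ - U w) * deriv U w) _ z :=
      ((hU1 z).const_sub γ).mul (hU2 z)
    have h0 := hODE z
    rw [h.deriv] at h0
    linear_combination h0
  let F : ℝ → ℝ := fun z => (1/2) * (γ - U z) ^ 2 * (deriv U z) ^ 2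
    + (γ / 2) * (U z) ^ 2 - (1/3) * (U z) ^ 3
  have hF (z : ℝ) : HasDerivAt F 0 z := by
    have h : HasDerivAt F _ z :=
      ((((((hU1 z).const_sub γ).fun_pow 2).const_mul (1/2)).fun_mul ((hU2 z).fun_pow 2)).fun_add
        (((hU1 z).fun_pow 2).const_mul (γ / 2))).fun_sub (((hU1 z).fun_pow 3).const_mul (1/3))
    convert h using 1
    norm_num
    linear_combination -(γ - U z) * deriv U z * ode z
  have hconst (z : ℝ) : F z = F 0 :=
    is_const_of_deriv_eq_zero (fun z => (hF z).differentiableAt) (fun z => (hF z).deriv) z 0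
  refine ⟨F 0, hconst, fun z => ?_⟩
  rw [← hconst z]
  linear_combination -3 * (γ - U z) ^ 2 * ode z
end

section
/- Let γ ∈ ℝ, Γ ∈ ℝ, and let U : ℝ → ℝ be a smooth, nonconstant, 2π-periodic solution of ((γ − U(z))·U'(z))' + U(z) = 0 with U(z) < γ and 1 − 3U''(z) > 0 for all z ∈ ℝ, and let I denote the constant value of the first-order invariant (then automatically γ³ − 6I > 0). Then U satisfies (1 − 3U''(z))·U''''(z) + 5·U'''(z)² + Γ·U(z)·(1 − 3U''(z))^{8/3} = 0 for all z ∈ ℝ if and only if Γ = −(γ³ − 6I)^{−2/3}. -/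
open Real

lemma ContDiff.hasDerivAt_iteratedDeriv {f : ℝ → ℝ} (hf : ContDiff ℝ (⊤ : ℕ∞) f) (n : ℕ) (z : ℝ) :
    HasDerivAt (iteratedDeriv n f) (iteratedDeriv (n + 1) f z) z := by
  rw [iteratedDeriv_succ]
  exact ((hf.differentiable_iteratedDeriv n (by exact_mod_cast WithTop.coe_lt_top n)) z).hasDerivAt

lemma rpow_eight_thirds_of_mul_cube_eq {a c K : ℝ} (ha : 0 < a) (hc : 0 < c)
    (h : a * c ^ 3 = K) : a ^ ((8 : ℝ) / 3) * c ^ 2 = a ^ 2 * K ^ ((2 : ℝ) / 3) := by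
  have hc3 : (c ^ 3) ^ ((2 : ℝ) / 3) = c ^ 2 := by
    rw [← rpow_natCast c 3, ← rpow_mul hc.le, ← rpow_natCast c 2]
    norm_num
  have ha8 : a ^ ((8 : ℝ) / 3) = a ^ 2 * a ^ ((2 : ℝ) / 3) := by
    rw [← rpow_natCast a 2, ← rpow_add ha]
    norm_num
  rw [← h, mul_rpow ha.le (by positivity), hc3, ha8]
  ring

theorem euler_lagrange_casimir_reduced_ostrovsky
    (γ Γ : ℝ) (U : ℝ → ℝ) (hU : ContDiff ℝ (⊤ : ℕ∞) U)
    (hnc : ∃ z w : ℝ, U z ≠ U w)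
    (hper : Function.Periodic U (2 * π))
    (hODE : ∀ z : ℝ, deriv (fun w => (γ - U w) * deriv U w) z + U z = 0)
    (hlt : ∀ z : ℝ, U z < γ)
    (hconv : ∀ z : ℝ, 0 < 1 - 3 * iteratedDeriv 2 U z)
    (I : ℝ)
    (hI : ∀ z : ℝ,
      (1/2) * (γ - U z) ^ 2 * (deriv U z) ^ 2
        + (γ / 2) * (U z) ^ 2 - (1/3) * (U z) ^ 3 = I) :
    (∀ z : ℝ,
        (1 - 3 * iteratedDeriv 2 U z) * iteratedDeriv 4 U z
          + 5 * (iteratedDeriv 3 U z) ^ 2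
          + Γ * U z * (1 - 3 * iteratedDeriv 2 U z) ^ ((8:ℝ)/3) = 0)
    ↔ Γ = -(γ ^ 3 - 6 * I) ^ (-(2:ℝ)/3) := by
  have d0 : ∀ z, HasDerivAt U (deriv U z) z := fun z => by
    simpa [iteratedDeriv_one] using hU.hasDerivAt_iteratedDeriv 0 z
  have d1 : ∀ z, HasDerivAt (deriv U) (iteratedDeriv 2 U z) z := fun z => by
    simpa [iteratedDeriv_one] using hU.hasDerivAt_iteratedDeriv 1 z
  have d2 := hU.hasDerivAt_iteratedDeriv 2
  have d3 := hU.hasDerivAt_iteratedDeriv 3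
  have dc : ∀ z, HasDerivAt (fun w => γ - U w) (-deriv U z) z := fun z => (d0 z).const_sub γ
  have hc : ∀ z, 0 < γ - U z := fun z => sub_pos.2 (hlt z)
  have da : ∀ z, HasDerivAt (fun w => 1 - 3 * iteratedDeriv 2 U w)
      (-(3 * iteratedDeriv 3 U z)) z := fun z => ((d2 z).const_mul 3).const_sub 1
  have second : ∀ z, (γ - U z) * iteratedDeriv 2 U z = deriv U z ^ 2 - U z := fun z => by
    have h := hODE z
    rw [((dc z).fun_mul (d1 z)).deriv] at h
    linear_combination h
  have hK : ∀ z, (1 - 3 * iteratedDeriv 2 U z) * (γ - U z) ^ 3 = γ ^ 3 - 6 * I := fun z => by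
    linear_combination (-3 * (γ - U z) ^ 2) * second z - 6 * hI z
  have third : ∀ z, (γ - U z) * iteratedDeriv 3 U z
      + (1 - 3 * iteratedDeriv 2 U z) * deriv U z = 0 := fun z => by
    have h := (da z).fun_mul ((dc z).fun_pow 3)
    rw [funext hK] at h
    have h0 := h.unique (hasDerivAt_const z _)
    have hne : -3 * (γ - U z) ^ 2 ≠ 0 := mul_ne_zero (by norm_num) (pow_ne_zero 2 (hc z).ne')
    apply mul_left_cancel₀ hne
    push_cast at h0
    linear_combination h0
  have fourth : ∀ z, (γ - U z) * iteratedDeriv 4 U z - 4 * deriv U z * iteratedDeriv 3 U z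
      + (1 - 3 * iteratedDeriv 2 U z) * iteratedDeriv 2 U z = 0 := fun z => by
    have h := ((dc z).fun_mul (d3 z)).fun_add ((da z).fun_mul (d1 z))
    rw [funext third] at h
    have h0 := h.unique (hasDerivAt_const z _)
    linear_combination h0
  have hKpos : 0 < γ ^ 3 - 6 * I := by
    rw [← hK 0]
    exact mul_pos (hconv 0) (pow_pos (hc 0) 3)
  have key : ∀ z, (γ - U z) ^ 2 * ((1 - 3 * iteratedDeriv 2 U z) * iteratedDeriv 4 U z
          + 5 * (iteratedDeriv 3 U z) ^ 2
          + Γ * U z * (1 - 3 * iteratedDeriv 2 U z) ^ ((8:ℝ)/3))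
      = (1 - 3 * iteratedDeriv 2 U z) ^ 2 * U z
        * (1 + Γ * (γ ^ 3 - 6 * I) ^ ((2:ℝ)/3)) := fun z => by
    have hr := rpow_eight_thirds_of_mul_cube_eq (hconv z) (hc z) (hK z)
    linear_combination (Γ * U z) * hr
      + ((1 - 3 * iteratedDeriv 2 U z) * (γ - U z)) * fourth z
      + (5 * (γ - U z) * iteratedDeriv 3 U z
        - (1 - 3 * iteratedDeriv 2 U z) * deriv U z) * third z
      - (1 - 3 * iteratedDeriv 2 U z) ^ 2 * second z
  have hΓ : Γ = -(γ ^ 3 - 6 * I) ^ (-(2:ℝ)/3)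
      ↔ 1 + Γ * (γ ^ 3 - 6 * I) ^ ((2:ℝ)/3) = 0 := by
    have hp := rpow_pos_of_pos hKpos ((2:ℝ)/3)
    rw [neg_div, rpow_neg hKpos.le]
    constructor
    · rintro h
      rw [h, neg_mul, inv_mul_cancel₀ hp.ne', add_neg_cancel]
    · intro h
      rw [eq_neg_iff_add_eq_zero]
      apply mul_right_cancel₀ hp.ne'
      rw [add_mul, inv_mul_cancel₀ hp.ne', zero_mul]
      linarith
  rw [hΓ]
  constructor
  · intro h
    obtain ⟨z, hz⟩ : ∃ z, U z ≠ 0 := by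
      by_contra! h0
      obtain ⟨z, w, hzw⟩ := hnc
      exact hzw (by rw [h0 z, h0 w])
    have hk := key z
    rw [h z, mul_zero] at hk
    exact (mul_eq_zero.1 hk.symm).resolve_left
      (mul_ne_zero (pow_ne_zero 2 (hconv z).ne') hz)
  · intro h z
    have hk := key z
    rw [h, mul_zero] at hk
    exact (mul_eq_zero.1 hk).resolve_left (pow_ne_zero 2 (hc z).ne')
end

section
/- Let γ ∈ ℝ and let U : ℝ → ℝ be a smooth solution of ((γ − U(z))·U'(z))' + U(z) = 0 with U(z) < γ for all z ∈ ℝ, and let I denote the constant value of the first-order invariant. Then (d²/dz²)[ (γ − U(z))⁵·U'''(z) ] = (γ³ − 6I)·U'(z) for every z ∈ ℝ. -/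
open Real

theorem kernel_identity_reduced_ostrovsky
    (γ : ℝ) (U : ℝ → ℝ) (hU : ContDiff ℝ (⊤ : ℕ∞) U)
    (hODE : ∀ z : ℝ, deriv (fun w => (γ - U w) * deriv U w) z + U z = 0)
    (hlt : ∀ z : ℝ, U z < γ)
    (I : ℝ)
    (hI : ∀ z : ℝ,
      (1/2) * (γ - U z) ^ 2 * (deriv U z) ^ 2
        + (γ / 2) * (U z) ^ 2 - (1/3) * (U z) ^ 3 = I) :
    ∀ z : ℝ,
      iteratedDeriv 2 (fun w => (γ - U w) ^ 5 * iteratedDeriv 3 U w) z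
        = (γ ^ 3 - 6 * I) * deriv U z := by
  have hd : ∀ n : ℕ, ∀ z, HasDerivAt (iteratedDeriv n U) (iteratedDeriv (n + 1) U z) z := by
    intro n z
    rw [iteratedDeriv_succ]
    exact (hU.differentiable_iteratedDeriv n (by exact_mod_cast WithTop.coe_lt_top n) z).hasDerivAt
  have h0 : ∀ z, HasDerivAt U (deriv U z) z := by
    simpa only [iteratedDeriv_zero, zero_add, iteratedDeriv_one] using hd 0
  have h1 : ∀ z, HasDerivAt (deriv U) (iteratedDeriv 2 U z) z := by
    simpa only [iteratedDeriv_one] using hd 1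
  have h2 : ∀ z, HasDerivAt (iteratedDeriv 2 U) (iteratedDeriv 3 U z) z := hd 2
  have second_order : ∀ z, (γ - U z) * iteratedDeriv 2 U z = deriv U z ^ 2 - U z := by
    intro z
    have h := (((h0 z).const_sub γ).fun_mul (h1 z)).deriv
    linear_combination hODE z - h
  have third_order : ∀ z,
      (γ - U z) * iteratedDeriv 3 U z = -(deriv U z * (1 - 3 * iteratedDeriv 2 U z)) := by
    intro z
    have hl := ((h0 z).const_sub γ).fun_mul (h2 z)
    have hr := ((h1 z).fun_pow 2).fun_sub (h0 z)
    rw [funext second_order] at hl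
    have h := hl.unique hr
    push_cast at h
    linear_combination h
  have conserved : ∀ z,
      (γ - U z) ^ 3 * (1 - 3 * iteratedDeriv 2 U z) = γ ^ 3 - 6 * I := by
    intro z
    linear_combination -3 * (γ - U z) ^ 2 * second_order z - 6 * hI z
  have weighted : (fun w => (γ - U w) ^ 5 * iteratedDeriv 3 U w)
      = fun w => -(γ ^ 3 - 6 * I) * ((γ - U w) * deriv U w) := by
    funext w
    linear_combination (γ - U w) ^ 4 * third_order w
      - (γ - U w) * deriv U w * conserved w
  have first_deriv : deriv (fun w => -(γ ^ 3 - 6 * I) * ((γ - U w) * deriv U w))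
      = fun w => (γ ^ 3 - 6 * I) * U w := by
    funext w
    rw [deriv_const_mul _ (((h0 w).const_sub γ).fun_mul (h1 w)).differentiableAt]
    linear_combination -(γ ^ 3 - 6 * I) * hODE w
  intro z
  rw [weighted, iteratedDeriv_succ, iteratedDeriv_one, first_deriv]
  exact ((h0 z).const_mul _).deriv
end
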